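/- arXiv:2107.02347 — 2 statements merged into one kernel-verified Lean document; each statement's English description precedes it below -/
import Mathlib

section
/- (Theorem 1, precision) In the E-NKCVS probability model, if μ(Selected) > 0, then the expected precision of the selected sample set, i.e. the conditional probability μ(Clean | Selected), equals [Σ_{k=t}^{M} binom(M,k) Σ_{i=1}^{Q} p_i T_{ii} C_{ii}^k (1 − C_{ii})^{M−k}] / [Σ_{k=t}^{M} binom(M,k) Σ_{i=1}^{Q} Σ_{j=1}^{Q} p_i T_{ij} C_{ij}^k (1 − C_{ij})^{M−k}]. -/
open Finset

/-- The total weight of the words `f : ι → κ` whose set of occurrences of the letter `j` is `A`. -/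
theorem sum_prod_filter_eq_set {ι κ R : Type*} [Fintype ι] [DecidableEq ι] [Fintype κ]
    [DecidableEq κ] [CommRing R] (c : κ → R) (j : κ) (A : Finset ι) :
    ∑ f : ι → κ with (univ.filter fun m => f m = j) = A, ∏ m, c (f m) =
      c j ^ #A * (∑ l, c l - c j) ^ (Fintype.card ι - #A) := by
  have hset : (univ.filter fun f : ι → κ => (univ.filter fun m => f m = j) = A) =
      Fintype.piFinset fun m => if m ∈ A then {j} else univ.erase j := by
    ext f
    simp only [mem_filter, mem_univ, true_and, Fintype.mem_piFinset, Finset.ext_iff]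
    refine forall_congr' fun m => ?_
    by_cases hm : m ∈ A <;> simp [hm]
  rw [hset, ← prod_univ_sum (fun m => if m ∈ A then {j} else univ.erase j) fun _ l => c l]
  have hsum (m : ι) : ∑ l ∈ (if m ∈ A then {j} else univ.erase j), c l =
      if m ∈ A then c j else ∑ l, c l - c j := by
    split_ifs
    · simp
    · exact sum_erase_eq_sub (mem_univ j)
  simp_rw [hsum]
  rw [prod_ite, prod_const, prod_const, filter_not, card_sdiff_of_subset (filter_subset _ _)]
  simp

/-- Binomial tail formula: the total weight of the words in which the letter `j` occurs at least
`t` times. -/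
theorem sum_prod_le_card_filter_eq {ι κ R : Type*} [Fintype ι] [DecidableEq ι] [Fintype κ]
    [DecidableEq κ] [CommRing R] (c : κ → R) (j : κ) (t : ℕ) :
    ∑ f : ι → κ with t ≤ #(univ.filter fun m => f m = j), ∏ m, c (f m) =
      ∑ k ∈ Icc t (Fintype.card ι), ((Fintype.card ι).choose k : R) *
        (c j ^ k * (∑ l, c l - c j) ^ (Fintype.card ι - k)) := by
  rw [← sum_fiberwise_of_maps_to (t := Icc t (Fintype.card ι))
    (g := fun f : ι → κ => #(univ.filter fun m => f m = j))
    fun f hf => mem_Icc.2 ⟨(mem_filter.1 hf).2, card_le_univ _⟩]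
  refine sum_congr rfl fun k hk => ?_
  rw [← sum_fiberwise_of_maps_to (t := powersetCard k (univ : Finset ι))
    (g := fun f : ι → κ => univ.filter fun m => f m = j)
    fun f hf => mem_powersetCard.2 ⟨subset_univ _, (mem_filter.1 hf).2⟩]
  rw [← card_univ (α := ι), ← card_powersetCard k univ, ← nsmul_eq_mul]
  refine sum_eq_card_nsmul fun A hA => ?_
  have hcard := (mem_powersetCard.1 hA).2
  rw [card_univ, ← hcard, ← sum_prod_filter_eq_set]
  refine sum_congr ?_ fun _ _ => rfl
  ext f
  simp only [mem_filter, mem_univ, true_and, and_iff_right_iff_imp]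
  rintro rfl
  exact ⟨hcard ▸ (mem_Icc.1 hk).1, rfl⟩

/-- Theorem 1 (precision): in the E-NKCVS probability model, if `μ(Selected) > 0`, the
    conditional probability `μ(Clean | Selected)` equals the stated ratio. -/
theorem enkcvs_precision (Q M t : ℕ)
    (hQ : 2 ≤ Q) (hM : 1 ≤ M) (ht1 : 1 ≤ t) (htM : t ≤ M)
    (p : Fin Q → ℝ) (T C : Fin Q → Fin Q → ℝ)
    (hp0 : ∀ i, 0 ≤ p i) (hp1 : ∑ i, p i = 1)
    (hT0 : ∀ i j, 0 ≤ T i j) (hT1 : ∀ i, ∑ j, T i j = 1)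
    (hC0 : ∀ i j, 0 ≤ C i j) (hC1 : ∀ i, ∑ j, C i j = 1)
    (μ : Fin Q × Fin Q × (Fin M → Fin Q) → ℝ)
    (hμ : ∀ i j f, μ (i, j, f) = p i * T i j * ∏ m, C i (f m))
    (Selected Clean : Finset (Fin Q × Fin Q × (Fin M → Fin Q)))
    (hSel : Selected =
      Finset.univ.filter (fun x => t ≤ (Finset.univ.filter (fun m => x.2.2 m = x.2.1)).card))
    (hCl : Clean = Finset.univ.filter (fun x => x.2.1 = x.1))
    (hpos : 0 < ∑ x ∈ Selected, μ x) :
    (∑ x ∈ Clean ∩ Selected, μ x) / (∑ x ∈ Selected, μ x) =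
      (∑ k ∈ Finset.Icc t M, (M.choose k : ℝ) *
          ∑ i, p i * T i i * C i i ^ k * (1 - C i i) ^ (M - k)) /
      (∑ k ∈ Finset.Icc t M, (M.choose k : ℝ) *
          ∑ i, ∑ j, p i * T i j * C i j ^ k * (1 - C i j) ^ (M - k)) := by
  subst hSel hCl
  have tail (i j : Fin Q) :
      ∑ f : Fin M → Fin Q, (if t ≤ #(univ.filter fun m => f m = j) then μ (i, j, f) else 0) =
        ∑ k ∈ Icc t M, (M.choose k : ℝ) * (p i * T i j * C i j ^ k * (1 - C i j) ^ (M - k)) := by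
    have h := sum_prod_le_card_filter_eq (ι := Fin M) (C i) j t
    rw [hC1, Fintype.card_fin] at h
    simp_rw [hμ]
    rw [← sum_filter, ← mul_sum, h, mul_sum]
    exact sum_congr rfl fun k _ => by ring
  congr 1
  · rw [← filter_and, sum_filter, Fintype.sum_prod_type]
    simp_rw [Fintype.sum_prod_type, ite_and, mul_sum]
    rw [sum_comm (s := Icc t M)]
    refine sum_congr rfl fun i _ => ?_
    rw [← tail, sum_eq_single i (fun j _ hj => by simp [hj]) (by simp)]
    simp
  · rw [sum_filter, Fintype.sum_prod_type]
    simp_rw [Fintype.sum_prod_type, tail, mul_sum]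
    rw [sum_comm (s := Icc t M)]
    exact sum_congr rfl fun i _ => sum_comm
end

section
/- (Theorem 1, recall) In the E-NKCVS probability model, if Σ_{i=1}^{Q} p_i T_{ii} > 0, then the expected recall of the selected sample set, i.e. the conditional probability μ(Selected | Clean), equals [Σ_{k=t}^{M} binom(M,k) Σ_{i=1}^{Q} p_i T_{ii} C_{ii}^k (1 − C_{ii})^{M−k}] / [Σ_{i=1}^{Q} p_i T_{ii}]. -/
open Finset

/-- Weight of the functions taking the value `a` exactly on `S`, under a product weight. -/
theorem sum_prod_filter_preimage_eq {ι α R : Type*} [Fintype ι] [DecidableEq ι] [Fintype α]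
    [DecidableEq α] [CommRing R] (c : α → R) (hc : ∑ j, c j = 1) (a : α) (S : Finset ι) :
    ∑ f : ι → α with (univ.filter fun m => f m = a) = S, ∏ m, c (f m) =
      c a ^ S.card * (1 - c a) ^ (Fintype.card ι - S.card) := by
  have hset : (univ.filter fun f : ι → α => (univ.filter fun m => f m = a) = S) =
      Fintype.piFinset fun m => if m ∈ S then {a} else univ.erase a := by
    ext f
    simp only [mem_filter, mem_univ, true_and, Fintype.mem_piFinset, Finset.ext_iff]
    refine forall_congr' fun m => ?_
    by_cases hm : m ∈ S <;> simp [hm]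
  have hsum (m : ι) : ∑ j ∈ (if m ∈ S then {a} else univ.erase a), c j =
      if m ∈ S then c a else 1 - c a := by
    split_ifs
    · simp
    · rw [sum_erase_eq_sub (mem_univ a), hc]
  rw [hset, ← prod_univ_sum]
  simp only [hsum]
  rw [prod_ite, prod_const, prod_const, filter_mem_eq_inter, univ_inter, filter_notMem_eq_sdiff,
    ← compl_eq_univ_sdiff, card_compl]

/-- The number of indices mapped to `a` is binomially distributed under a product weight. -/
theorem sum_card_filter_mul_prod {ι α R : Type*} [Fintype ι] [DecidableEq ι] [Fintype α]
    [DecidableEq α] [CommRing R] (c : α → R) (hc : ∑ j, c j = 1) (a : α) (g : ℕ → R) :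
    ∑ f : ι → α, g (univ.filter fun m => f m = a).card * ∏ m, c (f m) =
      ∑ k ∈ range (Fintype.card ι + 1),
        ((Fintype.card ι).choose k : R) * (g k * (c a ^ k * (1 - c a) ^ (Fintype.card ι - k))) := by
  rw [← sum_fiberwise univ fun f : ι → α => univ.filter fun m => f m = a]
  have hfib (S : Finset ι) :
      ∑ f : ι → α with (univ.filter fun m => f m = a) = S,
        g (univ.filter fun m => f m = a).card * ∏ m, c (f m) =
      g S.card * (c a ^ S.card * (1 - c a) ^ (Fintype.card ι - S.card)) := by
    rw [← sum_prod_filter_preimage_eq c hc, mul_sum]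
    refine sum_congr rfl fun f hf => ?_
    rw [(mem_filter.mp hf).2]
  simp only [hfib]
  rw [← powerset_univ, sum_powerset_apply_card
    (fun k => g k * (c a ^ k * (1 - c a) ^ (Fintype.card ι - k)))]
  simp only [card_univ, nsmul_eq_mul]

/-- The mass of the binomial distribution on the values at least `t`. -/
theorem sum_filter_le_card_prod {α R : Type*} [Fintype α] [DecidableEq α] [CommRing R]
    (M t : ℕ) (c : α → R) (hc : ∑ j, c j = 1) (a : α) :
    ∑ f : Fin M → α, (if t ≤ (univ.filter fun m => f m = a).card then ∏ m, c (f m) else 0) =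
      ∑ k ∈ Icc t M, (M.choose k : R) * (c a ^ k * (1 - c a) ^ (M - k)) := by
  have h := sum_card_filter_mul_prod (ι := Fin M) c hc a fun k => if t ≤ k then 1 else 0
  simp only [ite_mul, one_mul, zero_mul, Fintype.card_fin, mul_ite, mul_zero] at h
  rw [h, ← sum_filter]
  refine sum_congr ?_ fun _ _ => rfl
  ext k
  simp only [mem_filter, mem_range, mem_Icc]
  lia

/-- Theorem 1 (recall): in the E-NKCVS probability model, if `∑ i, p i * T i i > 0`, the
    conditional probability `μ(Selected | Clean)` equals the stated ratio. -/
theorem enkcvs_recall (Q M t : ℕ)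
    (hQ : 2 ≤ Q) (hM : 1 ≤ M) (ht1 : 1 ≤ t) (htM : t ≤ M)
    (p : Fin Q → ℝ) (T C : Fin Q → Fin Q → ℝ)
    (hp0 : ∀ i, 0 ≤ p i) (hp1 : ∑ i, p i = 1)
    (hT0 : ∀ i j, 0 ≤ T i j) (hT1 : ∀ i, ∑ j, T i j = 1)
    (hC0 : ∀ i j, 0 ≤ C i j) (hC1 : ∀ i, ∑ j, C i j = 1)
    (μ : Fin Q × Fin Q × (Fin M → Fin Q) → ℝ)
    (hμ : ∀ i j f, μ (i, j, f) = p i * T i j * ∏ m, C i (f m))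
    (Selected Clean : Finset (Fin Q × Fin Q × (Fin M → Fin Q)))
    (hSel : Selected =
      Finset.univ.filter (fun x => t ≤ (Finset.univ.filter (fun m => x.2.2 m = x.2.1)).card))
    (hCl : Clean = Finset.univ.filter (fun x => x.2.1 = x.1))
    (hpos : 0 < ∑ i, p i * T i i) :
    (∑ x ∈ Clean ∩ Selected, μ x) / (∑ x ∈ Clean, μ x) =
      (∑ k ∈ Finset.Icc t M, (M.choose k : ℝ) *
          ∑ i, p i * T i i * C i i ^ k * (1 - C i i) ^ (M - k)) /
      (∑ i, p i * T i i) := by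
  have hden : ∑ x ∈ Clean, μ x = ∑ i, p i * T i i := by
    rw [hCl, sum_filter, Fintype.sum_prod_type]
    refine sum_congr rfl fun i _ => ?_
    rw [Fintype.sum_prod_type, sum_comm]
    simp only [sum_ite_eq', mem_univ, if_true, hμ, ← mul_sum]
    rw [← Fintype.prod_sum]
    simp [hC1]
  have hnum : ∑ x ∈ Clean ∩ Selected, μ x = ∑ k ∈ Icc t M, (M.choose k : ℝ) *
      ∑ i, p i * T i i * C i i ^ k * (1 - C i i) ^ (M - k) := by
    simp only [mul_sum]
    rw [hCl, hSel, ← filter_and, sum_filter, Fintype.sum_prod_type, sum_comm (s := Icc t M)]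
    refine sum_congr rfl fun i _ => ?_
    rw [Fintype.sum_prod_type, sum_comm]
    simp only [ite_and, sum_ite_eq', mem_univ, if_true, hμ]
    simp only [← mul_ite_zero, ← mul_sum]
    rw [sum_filter_le_card_prod M t (C i) (hC1 i) i, mul_sum]
    exact sum_congr rfl fun k _ => by ring
  rw [hnum, hden]
end
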